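/- For every n, m ∈ ℤ, as ε → 0⁺ the band-limited frame vectors converge in L²(ℝ): lim_{ε→0⁺} ‖ψ̂^{ε}_{(n,m)} − ψ̂^{A,B}_{(n,m)}‖_{L²(ℝ)} = 0, where ψ̂^{ε}_{(n,m)} = I(ψ^{ε}_{(n,m)}) and ψ̂^{A,B}_{(n,m)} = I(ψ^{A,B}_{(n,m)}). -/

import Mathlib

open MeasureTheory Filter Topology

open scoped FourierTransform ContDiff ENNReal SchwartzMap

/-- On `L¹ ∩ L²`, the `L²` inverse Fourier transform is given by the Fourier integral. -/
theorem fourierInv_toLp_ae_eq {f : ℝ → ℂ} (hf : Integrable f) (hf2 : MemLp f 2) :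
    ⇑(𝓕⁻ (hf2.toLp f) : Lp ℂ 2 (volume : Measure ℝ)) =ᵐ[volume] 𝓕⁻ f := by
  have hcont : Continuous (𝓕⁻ f : ℝ → ℂ) := by
    rw [Real.fourierInv_eq_fourier_comp_neg]
    exact VectorFourier.fourierIntegral_continuous Real.continuous_fourierChar
      (by exact continuous_inner) hf.comp_neg
  refine ae_eq_of_integral_contDiff_smul_eq
    ((Lp.memLp _).locallyIntegrable (by norm_num)) hcont.locallyIntegrable ?_
  intro g hg hgc
  have hg₁ : HasCompactSupport (Complex.ofRealCLM ∘ g) := hgc.comp_left rfl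
  have hg₂ : ContDiff ℝ ∞ (Complex.ofRealCLM ∘ g) := by fun_prop
  set φ : 𝓢(ℝ, ℂ) := hg₁.toSchwartzMap hg₂ with hφ
  have hφa : ∀ x, φ x = (g x : ℂ) := fun x => rfl
  have h1 := congrArg (fun T => T φ) (Lp.fourierInv_toTemperedDistribution_eq (hf2.toLp f))
  simp only [TemperedDistribution.fourierInv_apply, Lp.toTemperedDistribution_apply] at h1
  have h2 : ∫ x, (𝓕⁻ φ) x • (hf2.toLp f) x = ∫ x, (𝓕⁻ φ) x • f x := by
    apply integral_congr_ae
    filter_upwards [hf2.coeFn_toLp] with x hx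
    rw [hx]
  have h3 : ∫ x, (𝓕⁻ φ) x • f x = ∫ x, φ x • 𝓕⁻ f x := by
    have := VectorFourier.integral_fourierIntegral_smul_eq_flip (μ := volume) (ν := volume)
      (L := -innerₗ ℝ) Real.continuous_fourierChar
      (by exact (continuous_inner.neg)) φ.integrable hf
    rw [show (-innerₗ ℝ : ℝ →ₗ[ℝ] ℝ →ₗ[ℝ] ℝ).flip = -innerₗ ℝ by ext; simp] at this
    rw [SchwartzMap.fourierInv_coe]
    exact this
  have h4 : ∀ F : ℝ → ℂ, ∫ x, φ x • F x = ∫ x, g x • F x := by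
    intro F; simp [hφa]
  rw [← h4, ← h4, ← h1, h2, h3]

theorem eLpNorm_fourierInv {f : ℝ → ℂ} (hf : Integrable f) (hf2 : MemLp f 2) :
    eLpNorm (𝓕⁻ f : ℝ → ℂ) 2 = eLpNorm f 2 := by
  rw [← eLpNorm_congr_ae (fourierInv_toLp_ae_eq hf hf2), ← eLpNorm_congr_ae hf2.coeFn_toLp,
    ← Lp.enorm_def, ← Lp.enorm_def]
  have : ‖(𝓕⁻ (hf2.toLp f) : Lp ℂ 2 (volume : Measure ℝ))‖ = ‖hf2.toLp f‖ :=
    (Lp.fourierTransformₗᵢ ℝ ℂ).symm.norm_map _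
  rw [← ofReal_norm, ← ofReal_norm, this]

theorem image_exp_neg_univ : (fun y : ℝ => Real.exp (-y)) '' Set.univ = Set.Ioi 0 := by
  rw [Set.image_univ]
  ext w
  simp only [Set.mem_range, Set.mem_Ioi]
  refine ⟨?_, fun hw => ⟨-Real.log w, by rw [neg_neg, Real.exp_log hw]⟩⟩
  rintro ⟨y, rfl⟩
  exact Real.exp_pos _

theorem hasDerivAt_exp_neg (y : ℝ) :
    HasDerivAt (fun y : ℝ => Real.exp (-y)) (-Real.exp (-y)) y := by
  simpa using (hasDerivAt_neg y).exp

theorem injective_exp_neg : Function.Injective (fun y : ℝ => Real.exp (-y)) :=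
  Real.exp_injective.comp neg_injective

/-- The unitary `L²(ℝ) → L²(0, ∞)` induced by the substitution `w = exp (-y)`, extended by zero. -/
noncomputable def logDilation (g : ℝ → ℂ) : ℝ → ℂ :=
  (Set.Ioi (0 : ℝ)).indicator fun w => g (-Real.log w) / Complex.ofReal (Real.sqrt w)

theorem eLpNorm_logDilation (g : ℝ → ℂ) : eLpNorm (logDilation g) 2 = eLpNorm g 2 := by
  rw [logDilation, eLpNorm_indicator_eq_eLpNorm_restrict measurableSet_Ioi,
    eLpNorm_eq_lintegral_rpow_enorm_toReal (by norm_num) (by norm_num),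
    eLpNorm_eq_lintegral_rpow_enorm_toReal (by norm_num) (by norm_num),
    ← image_exp_neg_univ, lintegral_image_eq_lintegral_abs_deriv_mul MeasurableSet.univ
      (fun y _ => (hasDerivAt_exp_neg y).hasDerivWithinAt) injective_exp_neg.injOn,
    Measure.restrict_univ]
  congr 1
  refine lintegral_congr fun y => ?_
  have hs : 0 < Real.sqrt (Real.exp (-y)) := Real.sqrt_pos.2 (Real.exp_pos _)
  rw [Real.log_exp, neg_neg, abs_neg, abs_of_pos (Real.exp_pos _), ← ofReal_norm, ← ofReal_norm,
    ENNReal.ofReal_rpow_of_nonneg (norm_nonneg _) (by norm_num),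
    ENNReal.ofReal_rpow_of_nonneg (norm_nonneg _) (by norm_num),
    ← ENNReal.ofReal_mul (Real.exp_pos _).le]
  congr 1
  rw [norm_div, Complex.norm_real, Real.norm_of_nonneg hs.le]
  simp only [ENNReal.toReal_ofNat, Real.rpow_two]
  rw [div_pow, Real.sq_sqrt (Real.exp_pos _).le]
  field_simp

theorem integrable_logDilation {g : ℝ → ℂ} {R : ℝ} (hg : MemLp g 2)
    (hR : ∀ᵐ x : ℝ, R < |x| → g x = 0) : Integrable (logDilation g) := by
  rw [logDilation, integrable_indicator_iff measurableSet_Ioi, ← image_exp_neg_univ,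
    integrableOn_image_iff_integrableOn_abs_deriv_smul MeasurableSet.univ
      (fun y _ => (hasDerivAt_exp_neg y).hasDerivWithinAt) injective_exp_neg.injOn,
    integrableOn_univ]
  have h1 : IntegrableOn g (Set.Icc (-R) R) :=
    (hg.locallyIntegrable (by norm_num)).integrableOn_isCompact isCompact_Icc
  have h2 : IntegrableOn (fun y => Complex.ofReal (Real.sqrt (Real.exp (-y))) * g y)
      (Set.Icc (-R) R) :=
    h1.continuousOn_mul (by fun_prop) isCompact_Icc
  rw [← integrable_indicator_iff measurableSet_Icc] at h2
  refine h2.congr ?_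
  filter_upwards [hR] with y hy
  have hs : 0 < Real.sqrt (Real.exp (-y)) := Real.sqrt_pos.2 (Real.exp_pos _)
  have hsq := Real.mul_self_sqrt (Real.exp_pos (-y)).le
  have hsc : (Real.sqrt (Real.exp (-y)) : ℂ) ≠ 0 := by exact_mod_cast hs.ne'
  rw [Real.log_exp, neg_neg, abs_neg, abs_of_pos (Real.exp_pos _), Complex.real_smul]
  by_cases hyR : y ∈ Set.Icc (-R) R
  · rw [Set.indicator_of_mem hyR]
    nth_rw 2 [← hsq]
    push_cast
    field_simp
  · rw [Set.indicator_of_notMem hyR, hy, zero_div, mul_zero]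
    by_contra! h
    exact hyR (abs_le.1 h)

theorem setIntegral_eq_fourierInv_logDilation (g : ℝ → ℂ) (x : ℝ) :
    ∫ w in Set.Ioi (0:ℝ), g (-Real.log w) / Complex.ofReal (Real.sqrt w) *
      Complex.exp (Complex.I * Complex.ofReal (x * w)) =
    𝓕⁻ (logDilation g) (x * (2 * Real.pi)⁻¹) := by
  rw [Real.fourierInv_eq', ← integral_indicator measurableSet_Ioi]
  refine integral_congr_ae (ae_of_all _ fun w => ?_)
  have : (2 * Real.pi * inner ℝ w (x * (2 * Real.pi)⁻¹)) = x * w := by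
    simp only [RCLike.inner_apply, conj_trivial]
    field_simp
  simp only [this]
  rw [logDilation]
  by_cases hw : w ∈ Set.Ioi (0:ℝ)
  · rw [Set.indicator_of_mem hw, Set.indicator_of_mem hw, smul_eq_mul, mul_comm Complex.I, mul_comm]
  · rw [Set.indicator_of_notMem hw, Set.indicator_of_notMem hw, smul_zero]

theorem eLpNorm_comp_mul_right {f : ℝ → ℂ} (hf : AEStronglyMeasurable f) {c : ℝ} (hc : 0 < c) :
    eLpNorm (fun x => f (x * c⁻¹)) 2 = ENNReal.ofReal (c ^ (1 / 2 : ℝ)) * eLpNorm f 2 := by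
  have hmap := Real.map_volume_mul_right (inv_ne_zero hc.ne')
  have h := eLpNorm_map_measure (p := 2) (μ := volume) (f := (· * c⁻¹)) (g := f)
    (by rw [hmap]; exact hf.smul_measure _) (by fun_prop)
  rw [hmap, eLpNorm_smul_measure_of_ne_top (by norm_num)] at h
  rw [show (fun x => f (x * c⁻¹)) = f ∘ (· * c⁻¹) from rfl, ← h, inv_inv, abs_of_pos hc,
    ← ENNReal.ofReal_rpow_of_pos hc]
  simp

theorem eLpNorm_fourierInv_logDilation {g : ℝ → ℂ} {R : ℝ} (hg : MemLp g 2)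
    (hR : ∀ᵐ x : ℝ, R < |x| → g x = 0) :
    eLpNorm (fun x : ℝ => Complex.ofReal ((2 * Real.pi) ^ (-(1/2 : ℝ))) *
      𝓕⁻ (logDilation g) (x * (2 * Real.pi)⁻¹)) 2 = eLpNorm g 2 := by
  have h1 := integrable_logDilation hg hR
  have h2 : MemLp (logDilation g) 2 := ⟨h1.1, by rw [eLpNorm_logDilation]; exact hg.2⟩
  have hm : AEStronglyMeasurable (𝓕⁻ (logDilation g)) :=
    (Lp.aestronglyMeasurable _).congr (fourierInv_toLp_ae_eq h1 h2)
  have hpi : 0 < 2 * Real.pi := by positivity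
  have := eLpNorm_const_smul (p := 2) (μ := volume)
    (Complex.ofReal ((2 * Real.pi) ^ (-(1/2 : ℝ))))
    (fun x : ℝ => 𝓕⁻ (logDilation g) (x * (2 * Real.pi)⁻¹))
  refine this.trans ?_
  rw [eLpNorm_comp_mul_right hm hpi, eLpNorm_fourierInv h1 h2, eLpNorm_logDilation,
    ← mul_assoc, ← ofReal_norm, Complex.norm_real, Real.norm_of_nonneg (by positivity),
    ← ENNReal.ofReal_mul (by positivity), ← Real.rpow_add hpi]
  simp

/-- Dominated convergence in `L²` for multiplication by locally uniformly bounded symbols. -/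
theorem tendsto_eLpNorm_mul_of_bounded {f : ℝ → ℂ} (hf : MemLp f 2) {M : ℝ → ℝ → ℂ} {C : ℝ}
    {l : Filter ℝ} [l.IsCountablyGenerated]
    (hM : ∀ᶠ ε in l, AEStronglyMeasurable (M ε))
    (hC : ∀ᶠ ε in l, ∀ᵐ x : ℝ, ‖M ε x * f x‖ ≤ C * ‖f x‖)
    (hlim : ∀ x, Tendsto (fun ε => M ε x) l (𝓝 0)) :
    Tendsto (fun ε => eLpNorm (fun x => M ε x * f x) 2) l (𝓝 0) := by
  have key : Tendsto (fun ε => ∫⁻ x, ‖M ε x * f x‖ₑ ^ (2:ℝ)) l (𝓝 (∫⁻ _ : ℝ, 0)) := by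
    refine tendsto_lintegral_filter_of_dominated_convergence'
      (fun x => ‖(C : ℂ) * f x‖ₑ ^ (2:ℝ)) ?_ ?_ ?_ ?_
    · filter_upwards [hM] with ε hε
      exact (hε.mul hf.1).enorm.pow_const _
    · filter_upwards [hC] with ε hε
      filter_upwards [hε] with x hx
      gcongr
      rw [enorm_le_iff_norm_le, norm_mul (C : ℂ), Complex.norm_real]
      exact hx.trans (by gcongr; exact Real.le_norm_self C)
    · have := (hf.const_mul (C : ℂ)).2
      rw [eLpNorm_eq_lintegral_rpow_enorm_toReal (by norm_num) (by norm_num)] at this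
      simpa using (ENNReal.rpow_lt_top_iff_of_pos (by norm_num)).1 this |>.ne
    · refine ae_of_all _ fun x => ?_
      have h0 : Tendsto (fun ε => M ε x * f x) l (𝓝 0) := by
        simpa using (hlim x).mul_const (f x)
      have h1 := (ENNReal.continuous_rpow_const (y := 2)).tendsto _ |>.comp h0.enorm
      simpa [Function.comp_def] using h1
  simp only [lintegral_zero] at key
  have h1 := (ENNReal.continuous_rpow_const (y := 1 / 2)).tendsto _ |>.comp key
  simp only [eLpNorm_eq_lintegral_rpow_enorm_toReal (p := 2) (by norm_num) (by norm_num)]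
  simpa [Function.comp_def] using h1

theorem tendsto_exp_sub_one_div (c : ℝ) :
    Tendsto (fun ε : ℝ => (Real.exp (ε * c) - 1) / ε) (𝓝[>] 0) (𝓝 c) := by
  have h : HasDerivAt (fun ε : ℝ => Real.exp (ε * c)) c 0 := by
    simpa using ((hasDerivAt_id (0:ℝ)).mul_const c).exp
  have := h.tendsto_slope_zero_right
  simpa [div_eq_inv_mul] using this

theorem tendsto_sinh_div (c : ℝ) :
    Tendsto (fun ε : ℝ => Real.sinh (ε * c) / ε) (𝓝[>] 0) (𝓝 c) := by
  have h : HasDerivAt (fun ε : ℝ => Real.sinh (ε * c)) c 0 := by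
    simpa using ((hasDerivAt_id (0:ℝ)).mul_const c).sinh
  have := h.tendsto_slope_zero_right
  simpa [div_eq_inv_mul] using this

theorem tendsto_exp_second_order (c : ℝ) :
    Tendsto (fun ε : ℝ => (Real.exp (ε * c) - 1 - ε * c) / ε ^ 2) (𝓝[>] 0) (𝓝 (c ^ 2 / 2)) := by
  rcases eq_or_ne c 0 with rfl | hc
  · simp
  have h := (Real.exp_sub_sum_range_succ_isLittleO_pow 2).tendsto_div_nhds_zero
  have hl : Tendsto (fun ε : ℝ => ε * c) (𝓝[>] 0) (𝓝 0) :=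
    ((continuous_mul_const c).tendsto' 0 0 (by simp)).mono_left nhdsWithin_le_nhds
  have h2 := (((h.comp hl).add_const (1 / 2)).const_mul (c ^ 2))
  rw [show c ^ 2 * (0 + 1 / 2) = c ^ 2 / 2 by ring] at h2
  refine h2.congr' ?_
  filter_upwards [self_mem_nhdsWithin] with ε hε
  have : ε ≠ 0 := ne_of_gt hε
  simp [Finset.sum_range_succ]
  field_simp
  ring

theorem tendsto_bernoulli_factor {c : ℝ} (hc : c ≠ 0) :
    Tendsto (fun ε : ℝ => (ε * c / (1 - Real.exp (-(ε * c))) - 1) / ε) (𝓝[>] 0) (𝓝 (c / 2)) := by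
  have h1 := tendsto_exp_second_order (-c)
  have h2 := tendsto_exp_sub_one_div (-c)
  have h3 := (h1.div h2 (neg_ne_zero.2 hc)).neg
  rw [show -((-c) ^ 2 / 2 / -c) = c / 2 by field_simp] at h3
  refine h3.congr' ?_
  filter_upwards [self_mem_nhdsWithin] with ε hε
  have : ε ≠ 0 := ne_of_gt hε
  have h4 : 1 - Real.exp (-(ε * c)) ≠ 0 := by
    rw [sub_ne_zero, ne_comm, Ne, Real.exp_eq_one_iff]
    simp [this, hc]
  have h5 : Real.exp (-(ε * c)) - 1 ≠ 0 := by
    rw [← neg_ne_zero, neg_sub]; exact h4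
  simp only [mul_neg, Pi.div_apply]
  field_simp
  rw [← neg_sub 1 (Real.exp _)]
  field_simp
  ring

/-- Convergence of the phases, with `r` the ratio of the two momentum parameters. -/
theorem tendsto_phase {A B L a₀ b₀ c k : ℝ} (hA : A ≠ 0) (hL : 0 < L) (hab : a₀ + b₀ = B)
    (hb : ∀ ε ∈ Set.Ioc (0:ℝ) 1, b₀ - A / ε ≠ 0) {β r : ℝ → ℝ}
    (hβ : ∀ ε, β ε = -Real.exp (-(ε * c)) * Real.pi * k / ((b₀ - A / ε) * Real.sinh (ε * L)))
    (hr : Tendsto (fun ε => (r ε - 1) / ε) (𝓝[>] 0) (𝓝 (c / 2))) (x : ℝ) :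
    Tendsto (fun ε => (a₀ + A / ε) * (β ε * r ε) + (b₀ - A / ε) * β ε * Real.exp (-(ε * x)))
      (𝓝[>] 0) (𝓝 (B * (Real.pi * k / (A * L)) + Real.pi * k / L * (x + c / 2))) := by
  have hid : Tendsto (fun ε : ℝ => ε) (𝓝[>] 0) (𝓝 0) := nhdsWithin_le_nhds
  have hr1 : Tendsto r (𝓝[>] 0) (𝓝 1) := by
    have := (hr.mul hid).add_const 1
    rw [mul_zero, zero_add] at this
    refine this.congr' ?_
    filter_upwards [self_mem_nhdsWithin] with ε hε
    have : ε ≠ 0 := ne_of_gt hε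
    field_simp
    ring
  have hexp : Tendsto (fun ε : ℝ => -Real.exp (-(ε * c)) * Real.pi * k) (𝓝[>] 0)
      (𝓝 (-Real.pi * k)) := by
    have : Continuous fun ε : ℝ => -Real.exp (-(ε * c)) * Real.pi * k := by fun_prop
    exact (this.tendsto' 0 _ (by simp)).mono_left nhdsWithin_le_nhds
  have hlin : Tendsto (fun ε : ℝ => b₀ * ε - A) (𝓝[>] 0) (𝓝 (-A)) := by
    have : Continuous fun ε : ℝ => b₀ * ε - A := by fun_prop
    exact (this.tendsto' 0 _ (by simp)).mono_left nhdsWithin_le_nhds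
  have hβ' : Tendsto β (𝓝[>] 0) (𝓝 (Real.pi * k / (A * L))) := by
    have := hexp.div (hlin.mul (tendsto_sinh_div L)) (mul_ne_zero (neg_ne_zero.2 hA) hL.ne')
    rw [show -Real.pi * k / (-A * L) = Real.pi * k / (A * L) by
      rw [neg_mul, neg_mul, neg_div_neg_eq]] at this
    refine this.congr' ?_
    filter_upwards [self_mem_nhdsWithin] with ε hε
    have : ε ≠ 0 := ne_of_gt hε
    rw [hβ, Pi.div_apply]
    congr 1
    field_simp
  have hdiff := ((hexp.mul ((tendsto_exp_sub_one_div (-x)).sub hr)).div (tendsto_sinh_div L) hL.ne')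
  have := ((hβ'.mul hr1).const_mul B).add hdiff
  rw [show B * (Real.pi * k / (A * L) * 1) + -Real.pi * k * (-x - c / 2) / L =
    B * (Real.pi * k / (A * L)) + Real.pi * k / L * (x + c / 2) by ring] at this
  refine this.congr' ?_
  filter_upwards [Ioc_mem_nhdsGT (zero_lt_one' ℝ)] with ε hε
  have h0 : ε ≠ 0 := ne_of_gt hε.1
  have hbe := hb ε hε
  have hs : Real.sinh (ε * L) ≠ 0 := (Real.sinh_pos_iff.2 (mul_pos hε.1 hL)).ne'
  have hbβ : (b₀ - A / ε) * β ε = -Real.exp (-(ε * c)) * Real.pi * k / Real.sinh (ε * L) := by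
    rw [hβ, mul_div_assoc', mul_div_mul_left _ _ hbe]
  have ha : a₀ + A / ε = B - (b₀ - A / ε) := by rw [← hab]; ring
  rw [Pi.div_apply, ha, sub_mul, ← mul_assoc (b₀ - A / ε), hbβ, mul_neg]
  field_simp
  ring

theorem logDilation_sub (g h : ℝ → ℂ) :
    logDilation (g - h) = logDilation g - logDilation h := by
  ext w
  by_cases hw : w ∈ Set.Ioi (0:ℝ) <;> simp [logDilation, hw, sub_div]

theorem fourierInv_sub_apply {f g : ℝ → ℂ} (hf : Integrable f) (hg : Integrable g) (x : ℝ) :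
    𝓕⁻ (f - g) x = 𝓕⁻ f x - 𝓕⁻ g x := by
  simp only [Real.fourierInv_eq, Pi.sub_apply, smul_sub]
  exact integral_sub (by simpa using (Real.fourierIntegral_convergent_iff (-x)).2 hf)
    (by simpa using (Real.fourierIntegral_convergent_iff (-x)).2 hg)

theorem contraction_of_band_limited_frame_vectors
    (A B L q₀ p₀ χ : ℝ)
    (hA : A ≠ 0) (hL : 0 < L) (hq₀ : q₀ ≠ 0) (hχ : 0 < χ)
    (hp₀ : p₀ = Real.pi / (A * L))
    (hq₀p₀ : |q₀ * p₀| < 2 * Real.pi)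
    (ψ : Lp ℂ 2 (volume : Measure ℝ)) (hψ : ψ ≠ 0)
    (hsupp : ∀ᵐ x : ℝ ∂volume, L < |x| → ψ x = 0)
    (hχsum : ∀ᵐ x : ℝ ∂volume, ∑' n : ℤ, ‖ψ (x + n * q₀)‖ ^ 2 = χ)
    (ψAB : ℤ → ℤ → Lp ℂ 2 (volume : Measure ℝ))
    (hψAB : ∀ n m : ℤ, ⇑(ψAB n m) =ᵐ[volume] fun x : ℝ =>
      Complex.exp (Complex.I * Complex.ofReal (A * m * n * q₀ * p₀ / 2)) *
      Complex.exp (Complex.I * Complex.ofReal (B * m * p₀)) *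
      Complex.exp (Complex.I * Complex.ofReal (Real.pi * m * x / L)) *
      ψ (x + n * q₀))
    (a₀ b₀ : ℝ) (hab : a₀ + b₀ = B)
    (hb : ∀ ε ∈ Set.Ioc (0:ℝ) 1, b₀ - A / ε ≠ 0)
    (β γ : ℝ → ℤ → ℤ → ℝ)
    (hβ : ∀ (ε : ℝ) (n m : ℤ), β ε n m =
      -Real.exp (-(ε * n * q₀)) * Real.pi * m / ((b₀ - A / ε) * Real.sinh (ε * L)))
    (hγ : ∀ (ε : ℝ) (n m : ℤ), n ≠ 0 → γ ε n m =
      β ε n m * (ε * n * q₀) / (1 - Real.exp (-(ε * n * q₀))))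
    (hγ₀ : ∀ (ε : ℝ) (m : ℤ), γ ε 0 m = β ε 0 m)
    (ψe : ℝ → ℤ → ℤ → Lp ℂ 2 (volume : Measure ℝ))
    (hψe : ∀ ε ∈ Set.Ioc (0:ℝ) 1, ∀ n m : ℤ, ⇑(ψe ε n m) =ᵐ[volume] fun x : ℝ =>
      Complex.exp (Complex.I * Complex.ofReal ((a₀ + A / ε) * γ ε n m)) *
      Complex.exp (Complex.I * Complex.ofReal ((b₀ - A / ε) * β ε n m * Real.exp (-(ε * x)))) *
      Complex.ofReal (Real.exp (-(ε * (x + n * q₀) / 2))) *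
      ψ (x + n * q₀))
    (ψhatAB : ℤ → ℤ → Lp ℂ 2 (volume : Measure ℝ))
    (hψhatAB : ∀ n m : ℤ, ⇑(ψhatAB n m) =ᵐ[volume] fun x : ℝ =>
      Complex.ofReal ((2 * Real.pi) ^ (-(1/2 : ℝ))) *
        ∫ w in Set.Ioi (0:ℝ), (ψAB n m) (-Real.log w) / Complex.ofReal (Real.sqrt w) *
          Complex.exp (Complex.I * Complex.ofReal (x * w)))
    (ψhate : ℝ → ℤ → ℤ → Lp ℂ 2 (volume : Measure ℝ))
    (hψhate : ∀ ε ∈ Set.Ioc (0:ℝ) 1, ∀ n m : ℤ, ⇑(ψhate ε n m) =ᵐ[volume] fun x : ℝ =>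
      Complex.ofReal ((2 * Real.pi) ^ (-(1/2 : ℝ))) *
        ∫ w in Set.Ioi (0:ℝ), (ψe ε n m) (-Real.log w) / Complex.ofReal (Real.sqrt w) *
          Complex.exp (Complex.I * Complex.ofReal (x * w)))
    (n m : ℤ) :
    Filter.Tendsto (fun ε : ℝ => ‖ψhate ε n m - ψhatAB n m‖) (𝓝[>] (0:ℝ)) (𝓝 0) := by
  set c : ℝ := n * q₀ with hc
  have hshift : MeasurePreserving (fun x : ℝ => x + c) volume volume :=
    measurePreserving_add_right _ _
  set f : ℝ → ℂ := fun x => ψ (x + c) with hf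
  have hfL : MemLp f 2 := (Lp.memLp ψ).comp_measurePreserving hshift
  have hfsupp : ∀ᵐ x : ℝ, L < |x + c| → f x = 0 := hshift.quasiMeasurePreserving.ae hsupp
  set M : ℝ → ℝ → ℂ := fun ε x =>
    Complex.exp (Complex.I * Complex.ofReal ((a₀ + A / ε) * γ ε n m)) *
      Complex.exp (Complex.I * Complex.ofReal ((b₀ - A / ε) * β ε n m * Real.exp (-(ε * x)))) *
      Complex.ofReal (Real.exp (-(ε * (x + n * q₀) / 2))) with hM
  set N : ℝ → ℂ := fun x =>
    Complex.exp (Complex.I * Complex.ofReal (A * m * n * q₀ * p₀ / 2)) *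
      Complex.exp (Complex.I * Complex.ofReal (B * m * p₀)) *
      Complex.exp (Complex.I * Complex.ofReal (Real.pi * m * x / L)) with hN
  have hexpI : ∀ t : ℝ, ‖Complex.exp (Complex.I * Complex.ofReal t)‖ = 1 := fun t => by
    rw [mul_comm, Complex.norm_exp_ofReal_mul_I]
  have hNe : ⇑(ψAB n m) =ᵐ[volume] fun x => N x * f x := hψAB n m
  have hMe : ∀ ε ∈ Set.Ioc (0:ℝ) 1, ⇑(ψe ε n m) =ᵐ[volume] fun x => M ε x * f x :=
    fun ε hε => hψe ε hε n m
  have hsupp' : ∀ᵐ x : ℝ, L + |c| < |x| → f x = 0 := by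
    filter_upwards [hfsupp] with x hx hlt
    refine hx ?_
    have := abs_sub (x + c) c
    rw [add_sub_cancel_right] at this
    linarith
  have hlim : ∀ x, Tendsto (fun ε => M ε x - N x) (𝓝[>] 0) (𝓝 0) := by
    intro x
    obtain ⟨r, hr, hγr⟩ : ∃ r : ℝ → ℝ, Tendsto (fun ε => (r ε - 1) / ε) (𝓝[>] 0) (𝓝 (c / 2)) ∧
        ∀ ε, γ ε n m = β ε n m * r ε := by
      rcases eq_or_ne n 0 with rfl | hn
      · exact ⟨fun _ => 1, by simp [hc], fun ε => by rw [hγ₀, mul_one]⟩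
      · refine ⟨fun ε => ε * c / (1 - Real.exp (-(ε * c))),
          tendsto_bernoulli_factor (mul_ne_zero (Int.cast_ne_zero.2 hn) hq₀), fun ε => ?_⟩
        simp only [hγ ε n m hn, hc, mul_div_assoc, mul_assoc]
    have hphase := tendsto_phase (β := fun ε => β ε n m) (c := c) (k := m) hA hL hab hb
      (fun ε => by rw [hβ, hc, ← mul_assoc]) hr x
    have hdil : Tendsto (fun ε : ℝ => Real.exp (-(ε * (x + n * q₀) / 2))) (𝓝[>] 0) (𝓝 1) := by
      have : Continuous fun ε : ℝ => Real.exp (-(ε * (x + n * q₀) / 2)) := by fun_prop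
      exact (this.tendsto' 0 _ (by simp)).mono_left nhdsWithin_le_nhds
    have hcexp : Continuous fun t : ℝ => Complex.exp (Complex.I * Complex.ofReal t) := by fun_prop
    have h := ((hcexp.tendsto _).comp hphase).mul ((Complex.continuous_ofReal.tendsto _).comp hdil)
    have hNx : N x = Complex.exp (Complex.I * Complex.ofReal
        (B * (Real.pi * m / (A * L)) + Real.pi * m / L * (x + c / 2))) * Complex.ofReal 1 := by
      rw [hN, Complex.ofReal_one, mul_one]
      dsimp only
      rw [← Complex.exp_add, ← Complex.exp_add, ← mul_add, ← mul_add, ← Complex.ofReal_add,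
        ← Complex.ofReal_add, hp₀, hc]
      congr 3
      field_simp
      ring
    rw [← hNx] at h
    have h' := h.sub_const (N x)
    rw [sub_self] at h'
    refine h'.congr fun ε => ?_
    simp only [hM, Function.comp_apply, hγr]
    rw [← Complex.exp_add, ← mul_add, ← Complex.ofReal_add]
  have hL2 : Tendsto (fun ε => eLpNorm (fun x => (M ε x - N x) * f x) 2) (𝓝[>] 0) (𝓝 0) := by
    refine tendsto_eLpNorm_mul_of_bounded (C := Real.exp (L / 2) + 1) hfL
      (Eventually.of_forall fun ε => ?_) ?_ hlim
    · have : Continuous fun x => M ε x - N x := by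
        simp only [hM, hN]
        fun_prop
      exact this.aestronglyMeasurable
    · filter_upwards [Ioc_mem_nhdsGT (zero_lt_one' ℝ)] with ε hε
      filter_upwards [hfsupp] with x hx
      by_cases hxL : L < |x + c|
      · simp [hx hxL]
      rw [norm_mul]
      gcongr
      refine (norm_sub_le _ _).trans ?_
      simp only [hM, hN, norm_mul, hexpI, Complex.norm_real, one_mul]
      rw [Real.norm_of_nonneg (Real.exp_pos _).le]
      gcongr
      have h1 := (abs_le.1 (not_lt.1 hxL)).1
      have h2 : ε * -(x + c) ≤ L :=
        (mul_le_mul_of_nonneg_left (neg_le.1 h1) hε.1.le).trans (mul_le_of_le_one_left hL.le hε.2)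
      rw [← hc]
      linarith
  have hnorm : ∀ ε ∈ Set.Ioc (0:ℝ) 1, ‖ψhate ε n m - ψhatAB n m‖ =
      (eLpNorm (fun x => (M ε x - N x) * f x) 2).toReal := by
    intro ε hε
    have hesupp : ∀ᵐ x : ℝ, L + |c| < |x| → ψe ε n m x = 0 := by
      filter_upwards [hMe ε hε, hsupp'] with x h1 h2 h3
      rw [h1, h2 h3, mul_zero]
    have hABsupp : ∀ᵐ x : ℝ, L + |c| < |x| → ψAB n m x = 0 := by
      filter_upwards [hNe, hsupp'] with x h1 h2 h3
      rw [h1, h2 h3, mul_zero]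
    have hdsupp : ∀ᵐ x : ℝ, L + |c| < |x| → (⇑(ψe ε n m) - ⇑(ψAB n m)) x = 0 := by
      filter_upwards [hesupp, hABsupp] with x h1 h2 h3
      rw [Pi.sub_apply, h1 h3, h2 h3, sub_zero]
    have hd : ⇑(ψe ε n m) - ⇑(ψAB n m) =ᵐ[volume] fun x => (M ε x - N x) * f x := by
      filter_upwards [hMe ε hε, hNe] with x h1 h2
      rw [Pi.sub_apply, h1, h2, sub_mul]
    rw [Lp.norm_def, ← eLpNorm_congr_ae hd, ← eLpNorm_fourierInv_logDilation
      ((Lp.memLp _).sub (Lp.memLp _)) hdsupp]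
    congr 1
    refine eLpNorm_congr_ae ?_
    filter_upwards [Lp.coeFn_sub (ψhate ε n m) (ψhatAB n m), hψhate ε hε n m, hψhatAB n m]
      with x h1 h2 h3
    rw [h1, Pi.sub_apply, h2, h3, setIntegral_eq_fourierInv_logDilation,
      setIntegral_eq_fourierInv_logDilation, logDilation_sub, ← mul_sub,
      fourierInv_sub_apply (integrable_logDilation (Lp.memLp _) hesupp)
        (integrable_logDilation (Lp.memLp _) hABsupp)]
  have hfin := (ENNReal.tendsto_toReal ENNReal.zero_ne_top).comp hL2
  rw [ENNReal.toReal_zero] at hfin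
  refine hfin.congr' ?_
  filter_upwards [Ioc_mem_nhdsGT (zero_lt_one' ℝ)] with ε hε
  exact (hnorm ε hε).symm
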